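/- arXiv:1308.3994 — 2 statements merged into one kernel-verified Lean document; each statement's English description precedes it below -/
import Mathlib

section
/- Let a > 1 and for each unit vector n ∈ ℝ³ let L_n := a^{2/3} n⊗n + a^{−1/3}(I − n⊗n). Then for every F ∈ ℝ^{3×3}, the minimum over n ∈ S² of tr(Fᵀ L_n^{−1} F) equals a^{1/3}‖F‖² − (a^{1/3} − a^{−2/3})·λ_max(FFᵀ), where ‖F‖ is the Frobenius norm and λ_max(FFᵀ) is the largest eigenvalue of the symmetric positive semidefinite matrix FFᵀ. Equivalently, writing 0 ≤ λ₁ ≤ λ₂ ≤ λ₃ for the ordered singular values of F (the square roots of the eigenvalues of FFᵀ), this minimum equals (λ₁/a^{−1/6})² + (λ₂/a^{−1/6})² + (λ₃/a^{1/3})². -/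
open Matrix Polynomial

noncomputable section

/-- Frobenius norm of a real `3 × 3` matrix. -/
def frob (F : Matrix (Fin 3) (Fin 3) ℝ) : ℝ :=
  Real.sqrt (∑ i, ∑ j, (F i j) ^ 2)

/-- The unit sphere condition for `n ∈ ℝ³`. -/
def unitVec (n : Fin 3 → ℝ) : Prop := ∑ i, (n i) ^ 2 = 1

/-- `L_n = a^{2/3} n⊗n + a^{-1/3}(I - n⊗n)`. -/
def Ln (a : ℝ) (n : Fin 3 → ℝ) : Matrix (Fin 3) (Fin 3) ℝ :=
  a ^ ((2 : ℝ) / 3) • Matrix.vecMulVec n n +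
    a ^ (-(1 : ℝ) / 3) • (1 - Matrix.vecMulVec n n)

/-- The eigenvalue condition `A v = μ v` with `v ≠ 0` says that `μ` is a root of the
characteristic polynomial. -/
lemma exists_mulVec_eq_smul_iff_eval_charpoly {ι : Type*} [Fintype ι] [DecidableEq ι]
    (A : Matrix ι ι ℝ) (μ : ℝ) :
    (∃ v : ι → ℝ, v ≠ 0 ∧ A.mulVec v = μ • v) ↔ A.charpoly.eval μ = 0 := by
  rw [Matrix.eval_charpoly, ← Matrix.exists_mulVec_eq_zero_iff]
  refine exists_congr fun v => and_congr_right fun _ => ?_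
  rw [Matrix.sub_mulVec, sub_eq_zero, Matrix.scalar_apply, ← Matrix.smul_one_eq_diagonal,
    Matrix.smul_mulVec, Matrix.one_mulVec, eq_comm]

/-- Rayleigh bound: a symmetric real matrix is dominated by any upper bound of its eigenvalues. -/
lemma dotProduct_mulVec_le_of_eigenvalue_le {ι : Type*} [Fintype ι] [DecidableEq ι]
    {A : Matrix ι ι ℝ} (hA : A.IsHermitian) {l : ℝ}
    (h : ∀ μ : ℝ, ∀ v : ι → ℝ, v ≠ 0 → A.mulVec v = μ • v → μ ≤ l) (x : ι → ℝ) :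
    x ⬝ᵥ A.mulVec x ≤ l * (x ⬝ᵥ x) := by
  have hB : (l • (1 : Matrix ι ι ℝ) - A).IsHermitian :=
    IsHermitian.sub (by simp [IsHermitian]) hA
  have hpos : (l • (1 : Matrix ι ι ℝ) - A).PosSemidef := by
    rw [hB.posSemidef_iff_eigenvalues_nonneg]
    intro i
    have hv := hB.mulVec_eigenvectorBasis i
    have hne : (hB.eigenvectorBasis i).ofLp ≠ 0 := fun h0 =>
      hB.eigenvectorBasis.orthonormal.ne_zero i (by ext j; exact congrFun h0 j)
    have := h (l - hB.eigenvalues i) _ hne (by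
      rw [sub_smul, ← hv, Matrix.sub_mulVec, Matrix.smul_mulVec, Matrix.one_mulVec,
        sub_sub_cancel])
    simpa using this
  have := hpos.dotProduct_mulVec_nonneg x
  simp only [star_trivial, Matrix.sub_mulVec, Matrix.smul_mulVec, Matrix.one_mulVec,
    dotProduct_sub, dotProduct_smul, smul_eq_mul] at this
  linarith

lemma frob_sq (F : Matrix (Fin 3) (Fin 3) ℝ) : frob F ^ 2 = Matrix.trace (F * Fᵀ) := by
  rw [frob, Real.sq_sqrt (by positivity)]
  simp [Matrix.trace, Matrix.mul_apply, sq]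

lemma unitVec_iff_dotProduct (n : Fin 3 → ℝ) : unitVec n ↔ n ⬝ᵥ n = 1 := by
  simp [unitVec, dotProduct, sq]

/-- `L_n⁻¹ = a^{1/3} I - (a^{1/3} - a^{-2/3}) n⊗n`. -/
lemma Ln_inv {a : ℝ} (ha : 0 < a) {n : Fin 3 → ℝ} (hn : unitVec n) :
    (Ln a n)⁻¹ = a ^ ((1 : ℝ) / 3) • (1 : Matrix (Fin 3) (Fin 3) ℝ) -
      (a ^ ((1 : ℝ) / 3) - a ^ (-(2 : ℝ) / 3)) • Matrix.vecMulVec n n := by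
  have hP : Matrix.vecMulVec n n * Matrix.vecMulVec n n = Matrix.vecMulVec n n := by
    rw [Matrix.vecMulVec_mul_vecMulVec, (unitVec_iff_dotProduct n).1 hn, one_smul]
  have h1 : a ^ ((2 : ℝ) / 3) * a ^ (-(2 : ℝ) / 3) = 1 := by
    rw [← Real.rpow_add ha]; norm_num
  have h2 : a ^ (-(1 : ℝ) / 3) * a ^ ((1 : ℝ) / 3) = 1 := by
    rw [← Real.rpow_add ha]; norm_num
  apply Matrix.inv_eq_right_inv
  rw [Ln]
  generalize Matrix.vecMulVec n n = P at *
  simp only [add_mul, mul_sub, sub_mul, smul_mul_assoc, mul_smul_comm, one_mul, mul_one, hP,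
    smul_sub, sub_self]
  linear_combination (norm := module) h1 • P + h2 • (1 - P)

lemma trace_conj_Ln_inv {a : ℝ} (ha : 0 < a) (F : Matrix (Fin 3) (Fin 3) ℝ)
    {n : Fin 3 → ℝ} (hn : unitVec n) :
    Matrix.trace (Fᵀ * (Ln a n)⁻¹ * F) = a ^ ((1 : ℝ) / 3) * frob F ^ 2 -
      (a ^ ((1 : ℝ) / 3) - a ^ (-(2 : ℝ) / 3)) * (n ⬝ᵥ (F * Fᵀ).mulVec n) := by
  rw [Matrix.mul_assoc, Matrix.trace_mul_comm, Matrix.mul_assoc, Ln_inv ha hn, frob_sq, sub_mul,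
    smul_mul_assoc, smul_mul_assoc, one_mul, Matrix.trace_sub, Matrix.trace_smul,
    Matrix.trace_smul, Matrix.vecMulVec_mul, Matrix.trace_vecMulVec,
    Matrix.dotProduct_mulVec, dotProduct_comm n, smul_eq_mul, smul_eq_mul]

/-- for `a > 1` and `F ∈ ℝ^{3×3}`, if `lmax` is the largest eigenvalue of
`F Fᵀ` and `0 ≤ λ₁ ≤ λ₂ ≤ λ₃` are the ordered singular values of `F` (so that the
characteristic polynomial of `F Fᵀ` is `(X - λ₁²)(X - λ₂²)(X - λ₃²)`), then
`min_{n ∈ S²} tr(Fᵀ L_n⁻¹ F) = a^{1/3}‖F‖² − (a^{1/3} − a^{−2/3}) lmax`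
`= (λ₁/a^{−1/6})² + (λ₂/a^{−1/6})² + (λ₃/a^{1/3})²`. -/
theorem min_trace_formula (a : ℝ) (ha : 1 < a) (F : Matrix (Fin 3) (Fin 3) ℝ)
    (lmax : ℝ)
    (hlmax : IsGreatest {μ : ℝ | ∃ v : Fin 3 → ℝ, v ≠ 0 ∧ (F * Fᵀ).mulVec v = μ • v} lmax)
    (l1 l2 l3 : ℝ) (hl1 : 0 ≤ l1) (h12 : l1 ≤ l2) (h23 : l2 ≤ l3)
    (hchar : (F * Fᵀ).charpoly =
      (X - C (l1 ^ 2)) * (X - C (l2 ^ 2)) * (X - C (l3 ^ 2))) :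
    IsLeast {t : ℝ | ∃ n : Fin 3 → ℝ, unitVec n ∧ t = Matrix.trace (Fᵀ * (Ln a n)⁻¹ * F)}
      (a ^ ((1 : ℝ) / 3) * (frob F) ^ 2 -
        (a ^ ((1 : ℝ) / 3) - a ^ (-(2 : ℝ) / 3)) * lmax) ∧
    a ^ ((1 : ℝ) / 3) * (frob F) ^ 2 - (a ^ ((1 : ℝ) / 3) - a ^ (-(2 : ℝ) / 3)) * lmax =
      (l1 / a ^ (-(1 : ℝ) / 6)) ^ 2 + (l2 / a ^ (-(1 : ℝ) / 6)) ^ 2 +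
        (l3 / a ^ ((1 : ℝ) / 3)) ^ 2 := by
  have ha0 : 0 < a := by linarith
  have hgap : 0 ≤ a ^ ((1 : ℝ) / 3) - a ^ (-(2 : ℝ) / 3) :=
    sub_nonneg.2 (Real.rpow_le_rpow_of_exponent_le ha.le (by norm_num))
  have hA : (F * Fᵀ).IsHermitian := by
    simpa using Matrix.isHermitian_mul_conjTranspose_self F
  refine ⟨⟨?_, ?_⟩, ?_⟩
  · obtain ⟨v, hv0, hv⟩ := hlmax.1
    have hvv : 0 < v ⬝ᵥ v := by
      simpa using Matrix.dotProduct_star_self_pos_iff.2 hv0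
    have hs : (Real.sqrt (v ⬝ᵥ v))⁻¹ * (Real.sqrt (v ⬝ᵥ v))⁻¹ * (v ⬝ᵥ v) = 1 := by
      rw [← mul_inv, Real.mul_self_sqrt hvv.le, inv_mul_cancel₀ hvv.ne']
    have hn : unitVec ((Real.sqrt (v ⬝ᵥ v))⁻¹ • v) := by
      rw [unitVec_iff_dotProduct, smul_dotProduct, dotProduct_smul, smul_eq_mul, smul_eq_mul,
        ← mul_assoc, hs]
    refine ⟨_, hn, ?_⟩
    rw [trace_conj_Ln_inv ha0 F hn, Matrix.mulVec_smul, hv, smul_comm, dotProduct_smul,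
      (unitVec_iff_dotProduct _).1 hn, smul_eq_mul, mul_one]
  · rintro t ⟨n, hn, rfl⟩
    rw [trace_conj_Ln_inv ha0 F hn]
    have := dotProduct_mulVec_le_of_eigenvalue_le hA
      (fun μ v hv0 hv => hlmax.2 ⟨v, hv0, hv⟩) n
    rw [(unitVec_iff_dotProduct n).1 hn, mul_one] at this
    gcongr
  · have hroot (μ : ℝ) : (∃ v : Fin 3 → ℝ, v ≠ 0 ∧ (F * Fᵀ).mulVec v = μ • v) ↔
        (μ - l1 ^ 2) * (μ - l2 ^ 2) * (μ - l3 ^ 2) = 0 := by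
      rw [exists_mulVec_eq_smul_iff_eval_charpoly, hchar]
      simp only [eval_mul, eval_sub, eval_X, eval_C]
    have hl : lmax = l3 ^ 2 := by
      have h13 : l1 ^ 2 ≤ l3 ^ 2 := by gcongr; exact h12.trans h23
      have h23' : l2 ^ 2 ≤ l3 ^ 2 := by
        have := hl1.trans h12
        gcongr
      refine le_antisymm ?_ (hlmax.2 ((hroot _).2 (by simp)))
      rcases mul_eq_zero.1 ((hroot _).1 hlmax.1) with h | h
      · rcases mul_eq_zero.1 h with h | h <;> linarith
      · linarith
    have htr : frob F ^ 2 = l1 ^ 2 + l2 ^ 2 + l3 ^ 2 := by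
      have hp : (X - C (l1 ^ 2)) * (X - C (l2 ^ 2)) * (X - C (l3 ^ 2)) =
          (∏ i : Fin 3, (X - C (![l1 ^ 2, l2 ^ 2, l3 ^ 2] i)) : ℝ[X]) := by
        simp [Fin.prod_univ_three]
      have hcoeff := Polynomial.prod_X_sub_C_coeff_card_pred Finset.univ
        ![l1 ^ 2, l2 ^ 2, l3 ^ 2] (by simp)
      rw [← hp, ← hchar] at hcoeff
      rw [frob_sq, Matrix.trace_eq_neg_charpoly_coeff]
      simp only [Finset.card_univ] at hcoeff
      rw [hcoeff, Fin.sum_univ_three]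
      simp
    have h6 : (a ^ (-(1 : ℝ) / 6)) ^ 2 = (a ^ ((1 : ℝ) / 3))⁻¹ := by
      rw [← Real.rpow_natCast, ← Real.rpow_mul ha0.le, ← Real.rpow_neg ha0.le]; norm_num
    have h3 : (a ^ ((1 : ℝ) / 3)) ^ 2 = (a ^ (-(2 : ℝ) / 3))⁻¹ := by
      rw [← Real.rpow_natCast, ← Real.rpow_mul ha0.le, ← Real.rpow_neg ha0.le]; norm_num
    rw [hl, htr, div_pow, div_pow, div_pow, h6, h3]
    simp only [div_inv_eq_mul]
    ring
end
end

section
/- Let μ > 0 and let W_vol : (0,∞) → ℝ be a C² function with W_vol(t) = 0 if and only if t = 1, W_vol(t) → +∞ as t → 0⁺, W_vol(t) ≥ k t² for all t ≥ M for some constants M, k > 0, and W_vol''(1) > 0. For ε > 0 and F ∈ ℝ^{3×3} with det F > 0, define W_ε(F) := min_{n ∈ S²} (μ/2)( tr(Fᵀ L_{n,ε}^{−1} F)/(det F)^{2/3} − 3 ) + W_vol(det F), where L_{n,ε} := (1+ε)² n⊗n + (1+ε)^{−1}(I − n⊗n). Define V on the 3×3 real symmetric matrices by V(E) := μ·min_{n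 ∈ S²} ‖E − U_n‖² + (λ/2)·tr²E, where U_n := (1/2)(3 n⊗n − I) and λ := W_vol''(1) − (2/3)μ. Then (1/ε²)·W_ε(I + εE) → V(E) as ε → 0⁺, uniformly on every compact subset of the 3×3 real symmetric matrices (for ε small enough, det(I+εE) > 0 on such a compact set, so the expression is well defined). -/
open Matrix Filter Topology

noncomputable section

/-- Distance (w.r.t. the Frobenius norm) from a matrix to a set of matrices. -/
def fdist (F : Matrix (Fin 3) (Fin 3) ℝ) (S : Set (Matrix (Fin 3) (Fin 3) ℝ)) : ℝ :=
  sInf ((fun G => frob (F - G)) '' S)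

/-- The special orthogonal group `SO(3)` as a set of matrices. -/
def SO3 : Set (Matrix (Fin 3) (Fin 3) ℝ) :=
  {R | R * Rᵀ = 1 ∧ R.det = 1}

/-- The unit sphere `S²` as a subtype of `ℝ³`. -/
def Sph : Type := {n : Fin 3 → ℝ // ∑ i, (n i) ^ 2 = 1}

/-- `L_{n,ε} = (1+ε)² n⊗n + (1+ε)⁻¹ (I - n⊗n)`. -/
def Lne (ε : ℝ) (n : Fin 3 → ℝ) : Matrix (Fin 3) (Fin 3) ℝ :=
  (1 + ε) ^ 2 • Matrix.vecMulVec n n + (1 + ε)⁻¹ • (1 - Matrix.vecMulVec n n)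

/-- `L_{n,ε}^{1/2} = (1+ε) n⊗n + (1+ε)^{-1/2} (I - n⊗n)`. -/
def LneHalf (ε : ℝ) (n : Fin 3 → ℝ) : Matrix (Fin 3) (Fin 3) ℝ :=
  (1 + ε) • Matrix.vecMulVec n n + ((1 + ε) ^ (-(1 : ℝ) / 2)) • (1 - Matrix.vecMulVec n n)

/-- The conditions on the volumetric energy `W_vol`. -/
structure WvolHyp (Wvol : ℝ → ℝ) : Prop where
  c2 : ContDiffOn ℝ 2 Wvol (Set.Ioi (0 : ℝ))
  zero_iff : ∀ t : ℝ, 0 < t → (Wvol t = 0 ↔ t = 1)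
  tendsto_top : Tendsto Wvol (𝓝[>] (0 : ℝ)) atTop
  quad_growth : ∃ M > (0 : ℝ), ∃ k > (0 : ℝ), ∀ t : ℝ, M ≤ t → k * t ^ 2 ≤ Wvol t
  second_deriv_pos : 0 < deriv (deriv Wvol) 1

/-- The small-strain nematic energy
`W_ε(F) = min_{n∈S²} (μ/2)(tr(Fᵀ L_{n,ε}⁻¹ F)/(det F)^{2/3} − 3) + W_vol(det F)`. -/
def Weps (μ : ℝ) (Wvol : ℝ → ℝ) (ε : ℝ) (F : Matrix (Fin 3) (Fin 3) ℝ) : ℝ :=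
  ⨅ n : Sph, (μ / 2 * (Matrix.trace (Fᵀ * (Lne ε n.1)⁻¹ * F) / F.det ^ ((2 : ℝ) / 3) - 3)
    + Wvol F.det)

/-- The wells `𝓤_ε = { R L_{n,ε}^{1/2} : n ∈ S², R ∈ SO(3) }`. -/
def Ueps (ε : ℝ) : Set (Matrix (Fin 3) (Fin 3) ℝ) :=
  {G | ∃ n : Fin 3 → ℝ, (∑ i, (n i) ^ 2 = 1) ∧ ∃ R ∈ SO3, G = R * LneHalf ε n}

/-- `U_n = (1/2)(3 n⊗n − I)`. -/
def Un (n : Fin 3 → ℝ) : Matrix (Fin 3) (Fin 3) ℝ :=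
  (1 / 2 : ℝ) • ((3 : ℝ) • Matrix.vecMulVec n n - 1)

/-- The limiting small-strain density
`V(E) = μ min_{n∈S²} ‖E − U_n‖² + (λ/2) tr²E` with `λ = W_vol''(1) − (2/3)μ`. -/
def Vlim (μ lam : ℝ) (E : Matrix (Fin 3) (Fin 3) ℝ) : ℝ :=
  μ * (⨅ n : Sph, (frob (E - Un n.1)) ^ 2) + lam / 2 * (Matrix.trace E) ^ 2

theorem exists_quadratic_remainder {f f' : ℝ → ℝ} {a c : ℝ}
    (hf : ∀ᶠ x in 𝓝 a, HasDerivAt f (f' x) x) (hf' : HasDerivAt f' c a) :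
    ∃ ρ : ℝ → ℝ, ContinuousAt ρ 0 ∧ ρ 0 = c / 2 ∧
      ∀ x, f (a + x) = f a + f' a * x + x ^ 2 * ρ x := by
  have htends : Tendsto (fun x => (f x - f a - f' a * (x - a)) / (x - a) ^ 2)
      (𝓝[≠] a) (𝓝 (c / 2)) := by
    apply HasDerivAt.lhopital_zero_nhdsNE (f' := fun x => f' x - f' a)
      (g' := fun x => 2 * (x - a))
    · filter_upwards [nhdsWithin_le_nhds hf] with x hx
      have h1 : HasDerivAt (fun x => f' a * (x - a)) (f' a * 1) x :=
        ((hasDerivAt_id x).sub_const a).const_mul (f' a)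
      exact ((hx.sub_const (f a)).sub h1).congr_deriv (by ring)
    · filter_upwards with x
      exact (((hasDerivAt_id x).sub_const a).pow 2).congr_deriv (by simp)
    · filter_upwards [self_mem_nhdsWithin] with x hx
      exact mul_ne_zero two_ne_zero (sub_ne_zero.mpr hx)
    · have h : ContinuousAt (fun x => f x - f a - f' a * (x - a)) a := by
        have := hf.self_of_nhds.continuousAt
        fun_prop
      simpa [ContinuousAt] using h.tendsto.mono_left (nhdsWithin_le_nhds (s := {a}ᶜ))
    · have h : ContinuousAt (fun x => (x - a) ^ 2) a := by fun_prop
      simpa [ContinuousAt] using h.tendsto.mono_left (nhdsWithin_le_nhds (s := {a}ᶜ))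
    · have h := (hasDerivAt_iff_tendsto_slope.mp hf').div_const 2
      refine h.congr fun x => ?_
      rw [slope_def_field, div_div, mul_comm (x - a)]
  let ρ : ℝ → ℝ := Function.update (fun x => (f (a + x) - f a - f' a * x) / x ^ 2) 0 (c / 2)
  refine ⟨ρ, ?_, by simp [ρ], fun x => ?_⟩
  · rw [continuousAt_update_same]
    have hadd : Tendsto (fun x : ℝ => a + x) (𝓝[≠] 0) (𝓝[≠] a) := by
      refine tendsto_nhdsWithin_iff.mpr ⟨?_, ?_⟩
      · have h : ContinuousAt (fun x : ℝ => a + x) 0 := by fun_prop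
        simpa [ContinuousAt] using h.tendsto.mono_left (nhdsWithin_le_nhds (s := {0}ᶜ))
      · filter_upwards [self_mem_nhdsWithin] with x hx
        simpa using hx
    simpa [Function.comp_def] using htends.comp hadd
  · rcases eq_or_ne x 0 with rfl | hx
    · simp
    · simp only [ρ, Function.update_of_ne hx]
      field_simp
      ring

namespace WvolHyp

variable {Wvol : ℝ → ℝ}

theorem nonneg (hW : WvolHyp Wvol) {t : ℝ} (ht : 0 < t) : 0 ≤ Wvol t := by
  have ivt : ∀ s : Set ℝ, IsPreconnected s → s ⊆ Set.Ioi 0 → (1 : ℝ) ∉ s →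
      ∀ a ∈ s, ∀ b ∈ s, 0 ≤ Wvol b → 0 ≤ Wvol a := by
    intro s hs hpos h1 a ha b hb hWb
    by_contra! hWa
    obtain ⟨c, hc, hWc⟩ := hs.intermediate_value ha hb (hW.c2.continuousOn.mono hpos)
      ⟨hWa.le, hWb⟩
    exact h1 ((hW.zero_iff c (hpos hc)).mp hWc ▸ hc)
  rcases lt_trichotomy t 1 with h | rfl | h
  · have hev : ∀ᶠ b in 𝓝[>] (0 : ℝ), 0 ≤ Wvol b := hW.tendsto_top.eventually_ge_atTop 0
    obtain ⟨b, hWb, hb⟩ := (hev.and (Ioo_mem_nhdsGT one_pos)).exists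
    exact ivt (Set.Ioo 0 1) isPreconnected_Ioo (fun x hx => hx.1) (by simp) t ⟨ht, h⟩ b hb hWb
  · exact ((hW.zero_iff 1 one_pos).mpr rfl).ge
  · obtain ⟨M, -, k, hk, hM⟩ := hW.quad_growth
    refine ivt (Set.Ioi 1) isPreconnected_Ioi (Set.Ioi_subset_Ioi zero_le_one) (by simp) t h
      (max M 2) ?_ ((by positivity : (0 : ℝ) ≤ k * max M 2 ^ 2).trans (hM _ (le_max_left _ _)))
    exact Set.mem_Ioi.mpr (one_lt_two.trans_le (le_max_right _ _))

theorem deriv_one (hW : WvolHyp Wvol) : deriv Wvol 1 = 0 := by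
  refine IsLocalMin.deriv_eq_zero ?_
  filter_upwards [lt_mem_nhds one_pos] with t ht
  rw [(hW.zero_iff 1 one_pos).mpr rfl]
  exact hW.nonneg ht

theorem exists_quadratic_factor (hW : WvolHyp Wvol) :
    ∃ σ : ℝ → ℝ, ContinuousAt σ 0 ∧ σ 0 = deriv (deriv Wvol) 1 / 2 ∧
      ∀ x, Wvol (1 + x) = x ^ 2 * σ x := by
  have hderiv : ∀ᶠ x in 𝓝 (1 : ℝ), HasDerivAt Wvol (deriv Wvol x) x := by
    filter_upwards [lt_mem_nhds one_pos] with x hx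
    exact ((hW.c2.contDiffAt (Ioi_mem_nhds hx)).differentiableAt two_ne_zero).hasDerivAt
  have hderiv2 : HasDerivAt (deriv Wvol) (deriv (deriv Wvol) 1) 1 := by
    have h : ContDiffOn ℝ 1 (deriv Wvol) (Set.Ioi 0) :=
      ((contDiffOn_succ_iff_deriv_of_isOpen (n := 1) isOpen_Ioi).mp
        (by simpa [one_add_one_eq_two] using hW.c2)).2.2
    exact ((h.contDiffAt (Ioi_mem_nhds one_pos)).differentiableAt one_ne_zero).hasDerivAt
  obtain ⟨σ, hσ, hσ0, h⟩ := exists_quadratic_remainder hderiv hderiv2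
  refine ⟨σ, hσ, hσ0, fun x => ?_⟩
  rw [h, hW.deriv_one, (hW.zero_iff 1 one_pos).mpr rfl]
  ring

end WvolHyp

theorem exists_rpow_neg_two_thirds_remainder :
    ∃ ρ : ℝ → ℝ, ContinuousAt ρ 0 ∧ ρ 0 = 5 / 9 ∧
      ∀ x, (1 + x) ^ (-(2 / 3) : ℝ) = 1 - 2 / 3 * x + x ^ 2 * ρ x := by
  have hderiv : ∀ᶠ x in 𝓝 (1 : ℝ), HasDerivAt (fun x : ℝ => x ^ (-(2 / 3) : ℝ))
      (-(2 / 3) * x ^ (-(2 / 3) - 1 : ℝ)) x := by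
    filter_upwards [lt_mem_nhds one_pos] with x hx
    exact Real.hasDerivAt_rpow_const (Or.inl hx.ne')
  have hderiv2 : HasDerivAt (fun x : ℝ => -(2 / 3) * x ^ (-(2 / 3) - 1 : ℝ)) (10 / 9) 1 := by
    exact ((Real.hasDerivAt_rpow_const (x := 1) (p := (-(2 / 3) - 1 : ℝ))
      (Or.inl one_ne_zero)).const_mul (-(2 / 3) : ℝ)).congr_deriv (by norm_num)
  obtain ⟨ρ, hρ, hρ0, h⟩ := exists_quadratic_remainder hderiv hderiv2
  refine ⟨ρ, hρ, by rw [hρ0]; norm_num, fun x => ?_⟩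
  rw [h]
  simp
  ring

/-- The sum of the squared entries of a matrix. -/
def sumSq (E : Matrix (Fin 3) (Fin 3) ℝ) : ℝ := ∑ i, ∑ j, E i j ^ 2

/-- The function `w` in the expansion `det (1 + ε E) = 1 + ε (tr E + ε w)`. -/
def detRemainder (ε : ℝ) (E : Matrix (Fin 3) (Fin 3) ℝ) : ℝ :=
  (E.trace ^ 2 - sumSq E) / 2 + ε * E.det

/-- The function `τ` in the expansion `tr (Fᵀ L⁻¹ F) = 3 + 2 ε tr E + ε² τ`
for `F = 1 + ε E` and `L = L_{n,ε}`. -/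
def traceRemainder (ε : ℝ) (E : Matrix (Fin 3) (Fin 3) ℝ) (n : Fin 3 → ℝ) : ℝ :=
  let κ := (3 + 2 * ε) / (1 + ε) ^ 2
  let q := n ⬝ᵥ E *ᵥ n
  let r := (E *ᵥ n) ⬝ᵥ (E *ᵥ n)
  κ - 6 * q + sumSq E + 2 * E.trace + ε * (2 * q * κ - 3 * r + sumSq E) + ε ^ 2 * (κ * r)

theorem Lne_inv {ε : ℝ} (hε : 1 + ε ≠ 0) {n : Fin 3 → ℝ} (hn : ∑ i, n i ^ 2 = 1) :
    (Lne ε n)⁻¹ = ((1 + ε) ^ 2)⁻¹ • vecMulVec n n + (1 + ε) • (1 - vecMulVec n n) := by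
  apply Matrix.inv_eq_right_inv
  have hP : vecMulVec n n * vecMulVec n n = vecMulVec n n := by
    have h : n ⬝ᵥ n = 1 := by simpa [dotProduct, sq] using hn
    rw [vecMulVec_mul_vecMulVec, h, one_smul]
  have hPQ : vecMulVec n n * (1 - vecMulVec n n) = 0 := by rw [mul_sub, hP, mul_one, sub_self]
  have hQP : (1 - vecMulVec n n) * vecMulVec n n = 0 := by rw [sub_mul, hP, one_mul, sub_self]
  have hQQ : (1 - vecMulVec n n) * (1 - vecMulVec n n) = 1 - vecMulVec n n := by
    rw [mul_sub, hQP, mul_one, sub_zero]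
  rw [Lne, add_mul, mul_add, mul_add]
  simp only [smul_mul_smul_comm, hP, hPQ, hQP, hQQ, smul_zero, add_zero, zero_add]
  rw [mul_inv_cancel₀ (pow_ne_zero 2 hε), inv_mul_cancel₀ hε]
  simp

theorem trace_Lne_inv {ε : ℝ} (hε : 1 + ε ≠ 0) {E : Matrix (Fin 3) (Fin 3) ℝ}
    (hE : E.IsSymm) {n : Fin 3 → ℝ} (hn : ∑ i, n i ^ 2 = 1) :
    trace ((1 + ε • E)ᵀ * (Lne ε n)⁻¹ * (1 + ε • E)) =
      3 + 2 * ε * E.trace + ε ^ 2 * traceRemainder ε E n := by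
  have h10 := hE.apply 0 1
  have h20 := hE.apply 0 2
  have h21 := hE.apply 1 2
  have hn' := hn
  rw [Fin.sum_univ_three] at hn'
  have hquad : ∀ α β : ℝ,
      trace ((1 + ε • E)ᵀ * (α • vecMulVec n n + β • (1 - vecMulVec n n)) * (1 + ε • E)) =
        α * (1 + 2 * ε * (n ⬝ᵥ E *ᵥ n) + ε ^ 2 * ((E *ᵥ n) ⬝ᵥ (E *ᵥ n))) +
        β * (2 + 2 * ε * (E.trace - n ⬝ᵥ E *ᵥ n) +
          ε ^ 2 * (sumSq E - (E *ᵥ n) ⬝ᵥ (E *ᵥ n))) := by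
    intro α β
    simp [trace_fin_three, Matrix.mul_apply, Fin.sum_univ_three, vecMulVec_apply, dotProduct,
      mulVec, sumSq, Matrix.one_apply, h10, h20, h21]
    linear_combination (α - β) * hn'
  rw [Lne_inv hε hn, hquad, traceRemainder]
  field_simp
  ring

theorem det_one_add_smul {ε : ℝ} {E : Matrix (Fin 3) (Fin 3) ℝ} (hE : E.IsSymm) :
    (1 + ε • E).det = 1 + ε * (E.trace + ε * detRemainder ε E) := by
  have h10 := hE.apply 0 1
  have h20 := hE.apply 0 2
  have h21 := hE.apply 1 2
  simp [detRemainder, det_fin_three, trace_fin_three, sumSq, Fin.sum_univ_three,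
    h10, h20, h21]
  ring

theorem frob_sub_Un_sq (E : Matrix (Fin 3) (Fin 3) ℝ) {n : Fin 3 → ℝ}
    (hn : ∑ i, n i ^ 2 = 1) :
    frob (E - Un n) ^ 2 = sumSq E - 3 * (n ⬝ᵥ E *ᵥ n) + E.trace + 3 / 2 := by
  rw [frob, Real.sq_sqrt (by positivity)]
  rw [Fin.sum_univ_three] at hn
  simp [Un, trace_fin_three, Fin.sum_univ_three, vecMulVec_apply, dotProduct,
    mulVec, sumSq, Matrix.one_apply]
  linear_combination (9 / 4 * (n 0 ^ 2 + n 1 ^ 2 + n 2 ^ 2) + 3 / 4) * hn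

/-- The rescaled energy density at a fixed director `n`, in terms of the remainder `ρ` of
`(1 + x) ^ (-2/3)` and the quadratic factor `σ` of the volumetric energy; it makes sense
also for `ε = 0`. -/
def rescaledDensity (μ : ℝ) (ρ σ : ℝ → ℝ) (ε : ℝ) (E : Matrix (Fin 3) (Fin 3) ℝ)
    (n : Fin 3 → ℝ) : ℝ :=
  let t := E.trace
  let w := detRemainder ε E
  let y := t + ε * w
  let τ := traceRemainder ε E n
  let ψ := y ^ 2 * ρ (ε * y) - 2 / 3 * w
  μ / 2 * (3 * ψ - 4 / 3 * t ^ 2 + τ + ε * (2 * t * ψ - 2 / 3 * t * τ) + ε ^ 2 * (τ * ψ)) +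
    y ^ 2 * σ (ε * y)

theorem continuousAt_rescaledDensity (μ : ℝ) {ρ σ : ℝ → ℝ} (hρ : ContinuousAt ρ 0)
    (hσ : ContinuousAt σ 0) (E : Matrix (Fin 3) (Fin 3) ℝ) (n : Fin 3 → ℝ) :
    ContinuousAt (fun z : ℝ × Matrix (Fin 3) (Fin 3) ℝ × (Fin 3 → ℝ) =>
      rescaledDensity μ ρ σ z.1 z.2.1 z.2.2) (0, E, n) := by
  have hy : ContinuousAt (fun z : ℝ × Matrix (Fin 3) (Fin 3) ℝ × (Fin 3 → ℝ) =>
      z.1 * (z.2.1.trace + z.1 * detRemainder z.1 z.2.1)) (0, E, n) := by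
    unfold detRemainder sumSq
    fun_prop
  have hρ' := ContinuousAt.comp_of_eq hρ hy (by simp)
  have hσ' := ContinuousAt.comp_of_eq hσ hy (by simp)
  have hτ : ContinuousAt (fun z : ℝ × Matrix (Fin 3) (Fin 3) ℝ × (Fin 3 → ℝ) =>
      traceRemainder z.1 z.2.1 z.2.2) (0, E, n) := by
    unfold traceRemainder sumSq
    fun_prop (disch := simp)
  have hw : ContinuousAt (fun z : ℝ × Matrix (Fin 3) (Fin 3) ℝ × (Fin 3 → ℝ) =>
      detRemainder z.1 z.2.1) (0, E, n) := by
    unfold detRemainder sumSq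
    fun_prop
  have ht : ContinuousAt (fun z : ℝ × Matrix (Fin 3) (Fin 3) ℝ × (Fin 3 → ℝ) =>
      z.2.1.trace) (0, E, n) := by fun_prop
  have hfst : ContinuousAt (fun z : ℝ × Matrix (Fin 3) (Fin 3) ℝ × (Fin 3 → ℝ) =>
      z.1) (0, E, n) := by fun_prop
  have hy2 := (ht.add (hfst.mul hw)).pow 2
  have hψ := (hy2.mul hρ').sub (hw.const_mul (2 / 3))
  exact (((((hψ.const_mul 3).sub ((ht.pow 2).const_mul (4 / 3))).add hτ).add
    (hfst.mul (((ht.const_mul 2).mul hψ).sub ((ht.const_mul (2 / 3)).mul hτ)))).add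
    ((hfst.pow 2).mul (hτ.mul hψ))).const_mul (μ / 2) |>.add (hy2.mul hσ')

theorem rescaledDensity_zero {μ c : ℝ} {ρ σ : ℝ → ℝ} (hρ : ρ 0 = 5 / 9) (hσ : σ 0 = c / 2)
    (E : Matrix (Fin 3) (Fin 3) ℝ) {n : Fin 3 → ℝ} (hn : ∑ i, n i ^ 2 = 1) :
    rescaledDensity μ ρ σ 0 E n =
      μ * frob (E - Un n) ^ 2 + (c - 2 / 3 * μ) / 2 * E.trace ^ 2 := by
  rw [frob_sub_Un_sq E hn]
  simp [rescaledDensity, traceRemainder, detRemainder, hρ, hσ]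
  ring

theorem rescaledDensity_eq (μ : ℝ) {Wvol ρ σ : ℝ → ℝ}
    (hρ : ∀ x, (1 + x) ^ (-(2 / 3) : ℝ) = 1 - 2 / 3 * x + x ^ 2 * ρ x)
    (hσ : ∀ x, Wvol (1 + x) = x ^ 2 * σ x) {ε : ℝ} (hε : 0 < ε)
    {E : Matrix (Fin 3) (Fin 3) ℝ} (hE : E.IsSymm) (hdet : 0 < (1 + ε • E).det)
    {n : Fin 3 → ℝ} (hn : ∑ i, n i ^ 2 = 1) :
    1 / ε ^ 2 * (μ / 2 * (trace ((1 + ε • E)ᵀ * (Lne ε n)⁻¹ * (1 + ε • E)) /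
      (1 + ε • E).det ^ ((2 : ℝ) / 3) - 3) + Wvol (1 + ε • E).det) =
      rescaledDensity μ ρ σ ε E n := by
  rw [div_eq_mul_inv (trace _), ← Real.rpow_neg hdet.le, det_one_add_smul hE, hρ, hσ,
    trace_Lne_inv (by positivity) hE hn, rescaledDensity]
  field_simp
  ring

instance : Nonempty Sph := ⟨⟨![1, 0, 0], by simp [Fin.sum_univ_three]⟩⟩

theorem Weps_rescaled_eq_iInf (μ : ℝ) {Wvol ρ σ : ℝ → ℝ}
    (hρ : ∀ x, (1 + x) ^ (-(2 / 3) : ℝ) = 1 - 2 / 3 * x + x ^ 2 * ρ x)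
    (hσ : ∀ x, Wvol (1 + x) = x ^ 2 * σ x) {ε : ℝ} (hε : 0 < ε)
    {E : Matrix (Fin 3) (Fin 3) ℝ} (hE : E.IsSymm) (hdet : 0 < (1 + ε • E).det) :
    1 / ε ^ 2 * Weps μ Wvol ε (1 + ε • E) = ⨅ n : Sph, rescaledDensity μ ρ σ ε E n.1 := by
  rw [Weps, Real.mul_iInf_of_nonneg (by positivity)]
  exact iInf_congr fun n => rescaledDensity_eq μ hρ hσ hε hE hdet n.2

theorem Vlim_eq_iInf {μ c : ℝ} (hμ : 0 ≤ μ) {ρ σ : ℝ → ℝ} (hρ : ρ 0 = 5 / 9)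
    (hσ : σ 0 = c / 2) (E : Matrix (Fin 3) (Fin 3) ℝ) :
    Vlim μ (c - 2 / 3 * μ) E = ⨅ n : Sph, rescaledDensity μ ρ σ 0 E n.1 := by
  have hbdd : BddBelow (Set.range fun n : Sph => μ * frob (E - Un n.1) ^ 2) := by
    refine ⟨0, ?_⟩
    rintro _ ⟨n, rfl⟩
    positivity
  rw [Vlim, Real.mul_iInf_of_nonneg hμ, ciInf_add hbdd]
  exact iInf_congr fun n => (rescaledDensity_zero hρ hσ E n.2).symm

theorem isCompact_unit_sphere : IsCompact {n : Fin 3 → ℝ | ∑ i, n i ^ 2 = 1} := by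
  refine (isCompact_univ_pi fun _ => isCompact_Icc (a := (-1 : ℝ)) (b := 1)).of_isClosed_subset
    (isClosed_eq (by fun_prop) continuous_const) fun n hn i _ => ?_
  rw [Set.mem_Icc, ← abs_le, ← sq_le_one_iff_abs_le_one, ← show ∑ i, n i ^ 2 = 1 from hn]
  exact Finset.single_le_sum (f := fun i => n i ^ 2) (fun j _ => sq_nonneg _) (Finset.mem_univ i)

theorem eventually_det_one_add_smul_pos {K : Set (Matrix (Fin 3) (Fin 3) ℝ)}
    (hK : IsCompact K) : ∀ᶠ ε in 𝓝 (0 : ℝ), ∀ E ∈ K, 0 < (1 + ε • E).det := by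
  refine hK.eventually_forall_of_forall_eventually fun E _ => ?_
  have hc : ContinuousAt (fun z : ℝ × Matrix (Fin 3) (Fin 3) ℝ => (1 + z.1 • z.2).det)
      (0, E) := by fun_prop
  exact hc.eventually (lt_mem_nhds (by simp))

theorem eventually_rescaledDensity_close (μ : ℝ) {ρ σ : ℝ → ℝ} (hρ : ContinuousAt ρ 0)
    (hσ : ContinuousAt σ 0) {K : Set (Matrix (Fin 3) (Fin 3) ℝ)} (hK : IsCompact K)
    {δ : ℝ} (hδ : 0 < δ) :
    ∀ᶠ ε in 𝓝 (0 : ℝ), ∀ p ∈ K ×ˢ {n : Fin 3 → ℝ | ∑ i, n i ^ 2 = 1},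
      |rescaledDensity μ ρ σ 0 p.1 p.2 - rescaledDensity μ ρ σ ε p.1 p.2| < δ := by
  refine (hK.prod isCompact_unit_sphere).eventually_forall_of_forall_eventually fun p _ => ?_
  have hc := continuousAt_rescaledDensity μ hρ hσ p.1 p.2
  have hproj : ContinuousAt (fun z : ℝ × Matrix (Fin 3) (Fin 3) ℝ × (Fin 3 → ℝ) =>
      ((0 : ℝ), z.2)) (0, p) := by fun_prop
  have hc0 := ContinuousAt.comp_of_eq hc hproj rfl
  have hlim := (hc0.sub hc).abs
  refine hlim.eventually (gt_mem_nhds ?_)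
  simpa only [Pi.sub_apply, Function.comp_apply, sub_self, abs_zero] using hδ

theorem abs_ciInf_sub_ciInf_le {ι : Type*} [Nonempty ι] {f g : ι → ℝ} {δ : ℝ}
    (hg : BddBelow (Set.range g)) (h : ∀ i, |g i - f i| ≤ δ) :
    |(⨅ i, g i) - ⨅ i, f i| ≤ δ := by
  obtain ⟨b, hb⟩ := hg
  have hf : BddBelow (Set.range f) := by
    refine ⟨b - δ, ?_⟩
    rintro _ ⟨i, rfl⟩
    linarith [hb ⟨i, rfl⟩, (abs_le.mp (h i)).2]
  rw [abs_sub_le_iff]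
  constructor
  · have : (⨅ i, g i) - δ ≤ ⨅ i, f i := le_ciInf fun i => by
      linarith [ciInf_le ⟨b, hb⟩ i, (abs_le.mp (h i)).2]
    linarith
  · have : (⨅ i, f i) - δ ≤ ⨅ i, g i := le_ciInf fun i => by
      linarith [ciInf_le hf i, (abs_le.mp (h i)).1]
    linarith

/-- `(1/ε²) W_ε(I + εE) → V(E)` as `ε → 0⁺`, uniformly on every compact
subset of the `3×3` real symmetric matrices. -/
theorem Weps_tendsto_V (μ : ℝ) (hμ : 0 < μ) (Wvol : ℝ → ℝ) (hW : WvolHyp Wvol)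
    (K : Set (Matrix (Fin 3) (Fin 3) ℝ)) (hK : IsCompact K)
    (hKsym : ∀ E ∈ K, E.IsSymm) :
    TendstoUniformlyOn (fun ε E => 1 / ε ^ 2 * Weps μ Wvol ε (1 + ε • E))
      (Vlim μ (deriv (deriv Wvol) 1 - 2 / 3 * μ)) (𝓝[>] (0 : ℝ)) K := by
  obtain ⟨ρ, hρc, hρ0, hρ⟩ := exists_rpow_neg_two_thirds_remainder
  obtain ⟨σ, hσc, hσ0, hσ⟩ := hW.exists_quadratic_factor
  have hdet := eventually_det_one_add_smul_pos hK
  rw [Metric.tendstoUniformlyOn_iff]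
  intro δ hδ
  have hclose := eventually_rescaledDensity_close μ hρc hσc hK (half_pos hδ)
  filter_upwards [nhdsWithin_le_nhds hdet, nhdsWithin_le_nhds hclose, self_mem_nhdsWithin]
    with ε hdetε hcloseε hε E hE
  have hε : 0 < ε := hε
  rw [Weps_rescaled_eq_iInf μ hρ hσ hε (hKsym E hE) (hdetε E hE),
    Vlim_eq_iInf hμ.le hρ0 hσ0, Real.dist_eq]
  have hpt : ∀ n : Sph,
      |rescaledDensity μ ρ σ 0 E n.1 - rescaledDensity μ ρ σ ε E n.1| ≤ δ / 2 := fun n =>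
    (hcloseε (E, n.1) (Set.mk_mem_prod hE n.2)).le
  have hbdd : BddBelow (Set.range fun n : Sph => rescaledDensity μ ρ σ 0 E n.1) := by
    refine ⟨(deriv (deriv Wvol) 1 - 2 / 3 * μ) / 2 * E.trace ^ 2, ?_⟩
    rintro _ ⟨n, rfl⟩
    simp only [rescaledDensity_zero hρ0 hσ0 E n.2]
    exact le_add_of_nonneg_left (by positivity)
  exact (abs_ciInf_sub_ciInf_le hbdd hpt).trans_lt (half_lt_self hδ)
end
end
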